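/- (Remaining top arms have large empirical means.) Every arm i ∈ Top ∩ I_r satisfies μ̂_i ≥ a − Δ_{π(n_{r+1})}/4, where a is the m_r-th largest empirical mean over I_r. -/

import Mathlib

/-- The `k`-th largest (1-indexed) value among `f 0, …, f (n-1)`; junk value `0` if out of range. -/
noncomputable def kthLargest {n : ℕ} (f : Fin n → ℝ) (k : ℕ) : ℝ :=
  if h : k - 1 < n then f (Tuple.sort f (Fin.rev ⟨k - 1, h⟩)) else 0

/-- The `k`-th smallest (1-indexed) value among `f 0, …, f (n-1)`; junk value `0` if out of range. -/
noncomputable def kthSmallest {n : ℕ} (f : Fin n → ℝ) (k : ℕ) : ℝ :=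
  if h : k - 1 < n then f (Tuple.sort f ⟨k - 1, h⟩) else 0

/-- The `k`-th largest (1-indexed) value of `f` over the finset `s`. -/
noncomputable def kthLargestOn {n : ℕ} (s : Finset (Fin n)) (f : Fin n → ℝ) (k : ℕ) : ℝ :=
  kthLargest (fun j : Fin s.card => f (s.orderIsoOfFin rfl j).1) k

/-- The `k`-th smallest (1-indexed) value of `f` over the finset `s`. -/
noncomputable def kthSmallestOn {n : ℕ} (s : Finset (Fin n)) (f : Fin n → ℝ) (k : ℕ) : ℝ :=
  kthSmallest (fun j : Fin s.card => f (s.orderIsoOfFin rfl j).1) k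

/-- At least `k` entries of `f` are no smaller than its `k`-th largest value. -/
theorem le_card_kthLargest_le {n : ℕ} (f : Fin n → ℝ) {k : ℕ} (hk : 1 ≤ k) (hkn : k ≤ n) :
    k ≤ (Finset.univ.filter fun j => kthLargest f k ≤ f j).card := by
  have h : k - 1 < n := by omega
  calc k = ((Finset.Ici (Fin.rev ⟨k - 1, h⟩)).map (Tuple.sort f).toEmbedding).card := by
        rw [Finset.card_map, Fin.card_Ici, Fin.val_rev]
        dsimp only
        omega
    _ ≤ _ := by
        refine Finset.card_le_card fun j hj => ?_
        obtain ⟨p, hp, rfl⟩ := Finset.mem_map.mp hj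
        rw [Finset.mem_filter, kthLargest, dif_pos h]
        exact ⟨Finset.mem_univ _, Tuple.monotone_sort f (Finset.mem_Ici.mp hp)⟩

/-- At least `k` elements of `s` have a value no smaller than the `k`-th largest value over `s`. -/
theorem le_card_kthLargestOn_le {n : ℕ} (s : Finset (Fin n)) (f : Fin n → ℝ) {k : ℕ}
    (hk : 1 ≤ k) (hks : k ≤ s.card) :
    k ≤ (s.filter fun j => kthLargestOn s f k ≤ f j).card := by
  refine (le_card_kthLargest_le (fun j : Fin s.card => f (s.orderIsoOfFin rfl j).1) hk hks).trans
    (Finset.card_le_card_of_injOn (fun j => (s.orderIsoOfFin rfl j).1) ?_ ?_)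
  · intro j hj
    exact Finset.mem_filter.mpr ⟨(s.orderIsoOfFin rfl j).2, (Finset.mem_filter.mp hj).2⟩
  · exact (Subtype.val_injective.comp (s.orderIsoOfFin rfl).injective).injOn

/-- Remaining top arms have large empirical means: every `i ∈ Top ∩ I_r` satisfies
`μ̂_i ≥ a − Δ_{π(n_{r+1})}/4`, where `a` is the `m_r`-th largest empirical mean over `I_r`. -/
theorem stmt12 (n m : ℕ) (hm : 1 ≤ m) (hmn : m < n) (μ : Fin n → ℝ)
    (Δ : Fin n → ℝ)
    (hΔ : ∀ i, Δ i = max (μ i - kthLargest μ (m + 1)) (kthLargest μ m - μ i))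
    (hpos : ∀ i, 0 < Δ i)
    (π : Equiv.Perm (Fin n)) (hπ : Monotone fun k => Δ (π k))
    (Top : Finset (Fin n)) (hTopcard : Top.card = m)
    (hTop : ∀ i ∈ Top, ∀ j ∉ Top, μ j < μ i)
    (nr n1 : ℕ) (hn1 : 1 ≤ n1) (hn1nr : n1 ≤ nr) (hnrn : nr ≤ n)
    (Ir Qr : Finset (Fin n)) (hIcard : Ir.card = nr)
    (hdisj : Disjoint Qr Ir) (hQTop : Qr ⊆ Top) (hTopQI : Top ⊆ Qr ∪ Ir)
    (mr : ℕ) (hmr : mr = m - Qr.card) (hmr1 : 1 ≤ mr) (hmrnr : mr + 1 ≤ nr)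
    (μhat : Fin n → ℝ)
    (happrox : ∀ i ∈ Ir, |μhat i - μ i| < Δ (π ⟨n1 - 1, by omega⟩) / 8)
    (a : ℝ) (ha : a = kthLargestOn Ir μhat mr) :
    ∀ i ∈ Top ∩ Ir, a - Δ (π ⟨n1 - 1, by omega⟩) / 4 ≤ μhat i := by
  intro i hi
  obtain ⟨hiTop, hiI⟩ := Finset.mem_inter.mp hi
  have hcard : (Top ∩ Ir).card = mr := by
    have hsdiff : Top ∩ Ir = Top \ Qr := by
      ext x
      have hQI : x ∈ Qr → x ∉ Ir := fun hx => Finset.disjoint_left.mp hdisj hx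
      have hcover : x ∈ Top → x ∈ Qr ∨ x ∈ Ir := fun hx => Finset.mem_union.mp (hTopQI hx)
      simp only [Finset.mem_inter, Finset.mem_sdiff]
      tauto
    rw [hsdiff, Finset.card_sdiff_of_subset hQTop, hTopcard, hmr]
  have hlarge : mr ≤ (Ir.filter fun j => a ≤ μhat j).card := by
    rw [ha]
    exact le_card_kthLargestOn_le Ir μhat hmr1 (by omega)
  by_contra! hlt
  obtain ⟨j, hj, hjTop⟩ := Finset.exists_mem_notMem_of_card_lt_card
    (s := (Top ∩ Ir).erase i) (t := Ir.filter fun j => a ≤ μhat j)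
    (by rw [Finset.card_erase_of_mem hi]; omega)
  obtain ⟨hjI, haj⟩ := Finset.mem_filter.mp hj
  have hD := hpos (π ⟨n1 - 1, by omega⟩)
  have hji : j ≠ i := by
    rintro rfl
    linarith
  have hj_notTop : j ∉ Top := fun h =>
    hjTop (Finset.mem_erase.mpr ⟨hji, Finset.mem_inter.mpr ⟨h, hjI⟩⟩)
  have hμ := hTop i hiTop j hj_notTop
  have hi_approx := (abs_lt.mp (happrox i hiI)).1
  have hj_approx := (abs_lt.mp (happrox j hjI)).2
  linarith
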